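/- arXiv:1806.10163 — 5 statements merged into one kernel-verified Lean document; each statement's English description precedes it below -/
import Mathlib

section
/- (Correctness of the FACT algorithm.) Let n ≥ 1 and for each size j ∈ {1,…,n} let Φ_j : [0,1]^j → {0,1} be a monotone and symmetric local testing rule. Let p ∈ [0,1]^n have distinct coordinates, sorted as p_(1) < ⋯ < p_(n). Then for every k ∈ {1,…,n}, the closed testing procedure rejects the hypothesis corresponding to p_(k) (i.e., Φ_{|J|}(p_J) = 1 for every subset J containing the index of p_(k)) if and only if for every m ∈ {1,…,k} and every j ∈ {m,…,n}, Φ_{n−j+1} applied to the vector (p_(m), p_(j+1), p_(j+2), …, p_(n)) equals 1 (where for j = n this vector is just the singleton (p_(m))). In other words, the FACT algorithm produces exactly the same rejections as closed testing. -/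
/-- `p` lies in the unit cube `[0,1]^j`. -/
def InBox {j : ℕ} (p : Fin j → ℝ) : Prop := ∀ i, p i ∈ Set.Icc (0 : ℝ) 1

/-- A local testing rule `Φ : [0,1]^j → {0,1}` is monotone if decreasing any
p-value preserves rejection. -/
def MonoRule {j : ℕ} (Φ : (Fin j → ℝ) → Bool) : Prop :=
  ∀ p q : Fin j → ℝ, InBox p → InBox q → (∀ i, p i ≤ q i) → Φ q = true → Φ p = true

/-- A local testing rule is symmetric if it is invariant under permutation of coordinates. -/
def SymmRule {j : ℕ} (Φ : (Fin j → ℝ) → Bool) : Prop :=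
  ∀ p : Fin j → ℝ, InBox p → ∀ π : Equiv.Perm (Fin j), Φ (p ∘ π) = Φ p

/-- The subvector of `p` with indices in `J`, as a vector of length `J.card`. -/
def subvec {n : ℕ} (p : Fin n → ℝ) (J : Finset (Fin n)) : Fin J.card → ℝ :=
  fun i => p (J.orderIsoOfFin rfl i)

/-- The local test on a subvector may be evaluated on any enumeration of the index set. -/
theorem SymmRule.subvec_eq {n s : ℕ} {Φ : (j : ℕ) → (Fin j → ℝ) → Bool} (hsymm : SymmRule (Φ s))
    {p : Fin n → ℝ} (hp : InBox p) {f : Fin s → Fin n} (hf : Function.Injective f)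
    {J : Finset (Fin n)} (hJ : Finset.univ.image f = J) :
    Φ J.card (subvec p J) = Φ s (p ∘ f) := by
  have hs : s = J.card := by
    rw [← hJ, Finset.card_image_of_injective _ hf, Finset.card_univ, Fintype.card_fin]
  subst hs
  have hmem : ∀ i, f i ∈ J := fun i => by
    have h := Finset.mem_image_of_mem f (Finset.mem_univ i)
    rwa [hJ] at h
  let g : Fin J.card → Fin J.card := fun i => (J.orderIsoOfFin rfl).symm ⟨f i, hmem i⟩
  have hg : Function.Injective g := fun a b hab =>
    hf (congrArg Subtype.val ((J.orderIsoOfFin rfl).symm.injective hab))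
  have h := hsymm (subvec p J) (fun i => hp _)
    (Equiv.ofBijective g (Finite.injective_iff_bijective.mp hg))
  rw [← h]
  congr 1
  funext i
  simp [subvec, g]

/-- A strictly monotone map between finite ordinals moves up at least one unit per step. -/
theorem StrictMono.fin_apply_add_le {s n : ℕ} {e : Fin s → Fin n} (he : StrictMono e) {i : ℕ} :
    ∀ (d : ℕ) (h : i + d < s), (e ⟨i, by omega⟩ : ℕ) + d ≤ e ⟨i + d, h⟩
  | 0, _ => le_rfl
  | d + 1, h => by
    have ih := he.fin_apply_add_le (i := i) d (by omega)
    have hlt : e ⟨i + d, by omega⟩ < e ⟨i + (d + 1), h⟩ := he (by simp [Fin.lt_def])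
    have := Fin.lt_def.mp hlt
    omega

/-- If closed testing rejects `σ κ`, then the local rule rejects any vector
`(x, p (σ j), …, p (σ (n - 1)))` with `x ≤ p (σ a)`, provided `κ` is among the
ranks `a, j, …, n - 1` (counted from zero). -/
theorem rule_cons_of_closed {n : ℕ} {Φ : (j : ℕ) → (Fin j → ℝ) → Bool} {p : Fin n → ℝ}
    (hp : InBox p) {σ : Equiv.Perm (Fin n)} {κ : Fin n}
    (hclosed : ∀ J : Finset (Fin n), σ κ ∈ J → Φ J.card (subvec p J) = true)
    {j : ℕ} (hmono : MonoRule (Φ (n - j + 1))) (hsymm : SymmRule (Φ (n - j + 1)))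
    {a : Fin n} (haj : a.1 < j) (hκ : κ = a ∨ j ≤ κ.1) {x : ℝ} (hx0 : x ∈ Set.Icc (0 : ℝ) 1)
    (hx : x ≤ p (σ a)) :
    Φ (n - j + 1) (Fin.cons x
      (fun i : Fin (n - j) => p (σ ⟨j + i.1, by have := i.isLt; omega⟩))) = true := by
  let e : Fin (n - j + 1) → Fin n :=
    Fin.cons a (fun i : Fin (n - j) => ⟨j + i.1, by have := i.isLt; omega⟩)
  have he : Function.Injective e := by
    refine Fin.cons_injective_iff.mpr ⟨?_, fun b c hbc => ?_⟩
    · rintro ⟨i, hi⟩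
      have := congrArg Fin.val hi
      simp only at this
      omega
    · have := congrArg Fin.val hbc
      simp only at this
      exact Fin.ext (by omega)
  have hmem : σ κ ∈ Finset.univ.image (σ ∘ e) := by
    rw [Finset.mem_image]
    rcases hκ with rfl | h
    · exact ⟨0, Finset.mem_univ _, rfl⟩
    · refine ⟨Fin.succ ⟨κ.1 - j, by omega⟩, Finset.mem_univ _, congrArg σ (Fin.ext ?_)⟩
      simp only [e, Fin.cons_succ]
      omega
  have hrej := hclosed _ hmem
  rw [hsymm.subvec_eq hp (σ.injective.comp he) rfl] at hrej
  refine hmono _ _ (Fin.cases hx0 fun i => hp _) (fun i => hp _) (Fin.cases hx fun i => ?_) hrej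
  exact le_rfl


/-- **Correctness of the FACT algorithm.** With a monotone symmetric local rule `Φ j`
for each subset size `j`, and distinct p-values sorted via the permutation `σ`
(so `p (σ ⟨m-1⟩)` is the `m`-th order statistic `p_(m)`), closed testing rejects the
hypothesis of `p_(k)` iff for every `m ∈ {1,…,k}` and every `j ∈ {m,…,n}` the rule
`Φ (n-j+1)` rejects the vector `(p_(m), p_(j+1), …, p_(n))`: the FACT algorithm gives
exactly the rejections of closed testing. -/
theorem fact_algorithm_correct
    (n : ℕ) (hn : 1 ≤ n)
    (Φ : (j : ℕ) → (Fin j → ℝ) → Bool)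
    (hmono : ∀ j, 1 ≤ j → j ≤ n → MonoRule (Φ j))
    (hsymm : ∀ j, 1 ≤ j → j ≤ n → SymmRule (Φ j))
    (p : Fin n → ℝ) (hp : InBox p) (hdistinct : Function.Injective p)
    (σ : Equiv.Perm (Fin n)) (hsort : StrictMono (p ∘ σ))
    (k : ℕ) (hk1 : 1 ≤ k) (hkn : k ≤ n) :
    (∀ J : Finset (Fin n), σ ⟨k - 1, by omega⟩ ∈ J → Φ J.card (subvec p J) = true)
      ↔ (∀ m, ∀ _hm1 : 1 ≤ m, ∀ _hm2 : m ≤ k, ∀ j, ∀ _hj1 : m ≤ j, ∀ _hj2 : j ≤ n,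
          Φ (n - j + 1)
            (Fin.cons (p (σ ⟨m - 1, by omega⟩))
              (fun i : Fin (n - j) => p (σ ⟨j + i.1, by have := i.isLt; omega⟩)))
            = true) := by
  constructor
  · intro hclosed m hm1 hm2 j hj1 hj2
    have hmono' := hmono (n - j + 1) (by omega) (by omega)
    have hsymm' := hsymm (n - j + 1) (by omega) (by omega)
    by_cases hjk : j < k
    · exact rule_cons_of_closed hp hclosed hmono' hsymm' (a := ⟨m - 1, by omega⟩)
        (by simp only; omega) (Or.inr (Nat.le_sub_one_of_lt hjk)) (hp _) le_rfl
    · exact rule_cons_of_closed hp hclosed hmono' hsymm' (a := ⟨k - 1, by omega⟩)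
        (by simp only; omega) (Or.inl rfl) (hp _)
        (hsort.monotone (Fin.mk_le_mk.mpr (by omega)))
  · intro hfact J hJ
    have hpos : 0 < J.card := Finset.card_pos.mpr ⟨_, hJ⟩
    have hle : J.card ≤ n := by simpa using Finset.card_le_univ J
    obtain ⟨j, hj⟩ : ∃ j, j = n + 1 - J.card := ⟨_, rfl⟩
    let K : Finset (Fin n) := J.map σ.symm.toEmbedding
    have hK : K.card = n - j + 1 := by
      rw [Finset.card_map]
      omega
    let e := K.orderEmbOfFin hK
    have he : StrictMono e := e.strictMono
    have hrange : Finset.univ.image e = K := K.image_orderEmbOfFin_univ hK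
    have himage : Finset.univ.image (σ ∘ e) = J := by
      rw [← Finset.image_image, hrange]
      ext x
      simp only [K, Finset.mem_image, Finset.mem_map_equiv, Equiv.symm_symm]
      exact ⟨fun ⟨y, hy, h⟩ => h ▸ hy, fun h => ⟨σ.symm x, by simpa using h, by simp⟩⟩
    have h0k : (e 0 : ℕ) ≤ k - 1 := by
      have hk : (⟨k - 1, by omega⟩ : Fin n) ∈ Finset.univ.image e := by
        rw [hrange]
        simpa [K] using hJ
      obtain ⟨i, -, hi⟩ := Finset.mem_image.mp hk
      have : e 0 ≤ e i := he.monotone (Fin.zero_le i)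
      rw [hi] at this
      exact this
    have h0j : (e 0 : ℕ) + 1 ≤ j := by
      have h1 : (e 0 : ℕ) + (n - j) ≤ e ⟨0 + (n - j), by omega⟩ :=
        he.fin_apply_add_le (i := 0) (n - j) (by omega)
      have h2 := (e ⟨0 + (n - j), by omega⟩).isLt
      omega
    have hrej := hfact (e 0 + 1) (by omega) (by omega) j h0j (by omega)
    have hmono' := hmono (n - j + 1) (by omega) (by omega)
    have hsymm' := hsymm (n - j + 1) (by omega) (by omega)
    rw [hsymm'.subvec_eq hp (σ.injective.comp he.injective) himage]
    refine hmono' _ _ (fun i => hp _) (Fin.cases (hp _) fun i => hp _)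
      (Fin.cases le_rfl fun i => hsort.monotone (Fin.le_def.mpr ?_)) hrej
    have hi := i.isLt
    have h1 : (e i.succ : ℕ) + (n - j - 1 - i) ≤ e ⟨i + 1 + (n - j - 1 - i), by omega⟩ :=
      he.fin_apply_add_le (n - j - 1 - i) (by omega)
    have h2 := (e ⟨i + 1 + (n - j - 1 - i), by omega⟩).isLt
    change (e i.succ : ℕ) ≤ j + i
    omega
end

section
/- (FACT for Bonferroni equals Holm's procedure.) Let n ≥ 1, α ∈ (0,1), and let p ∈ [0,1]^n have distinct coordinates with order statistics p_(1) < ⋯ < p_(n). For each nonempty J ⊆ {1,…,n}, let the Bonferroni local rule be Φ_J(p_J) = 1 if and only if min_{i∈J} p_i ≤ α/|J|. Then the closed testing procedure rejects the hypothesis corresponding to p_(k) if and only if p_(m) ≤ α/(n−m+1) for every m ∈ {1,…,k}; i.e., the closure of the Bonferroni method yields exactly the rejections of Holm's procedure. -/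
/-- **The closure of the Bonferroni method is Holm's procedure.** With distinct
p-values sorted via the permutation `σ` (so `p (σ ⟨m-1⟩)` is the `m`-th order statistic
`p_(m)`), the closed testing procedure built on the Bonferroni local rules
(`Φ_J` rejects iff `min_{i ∈ J} p_i ≤ α/|J|`) rejects the hypothesis of `p_(k)` iff
`p_(m) ≤ α/(n−m+1)` for every `m ∈ {1,…,k}`, i.e. iff Holm's procedure rejects it. -/
theorem fact_bonferroni_is_holm
    (n : ℕ) (hn : 1 ≤ n) (α : ℝ) (hα : α ∈ Set.Ioo (0 : ℝ) 1)
    (p : Fin n → ℝ) (hp : ∀ i, p i ∈ Set.Icc (0 : ℝ) 1)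
    (σ : Equiv.Perm (Fin n)) (hsort : StrictMono (p ∘ σ))
    (k : ℕ) (hk1 : 1 ≤ k) (hkn : k ≤ n) :
    (∀ J : Finset (Fin n), σ ⟨k - 1, by omega⟩ ∈ J →
        ∃ i ∈ J, p i ≤ α / (J.card : ℝ))
      ↔ (∀ m, ∀ _hm1 : 1 ≤ m, ∀ _hm2 : m ≤ k,
          p (σ ⟨m - 1, by omega⟩) ≤ α / ((n - m + 1 : ℕ) : ℝ)) := by
  constructor
  · intro h m hm1 hm2
    obtain ⟨i, hi, hle⟩ := h ((Finset.Ici (⟨m - 1, by omega⟩ : Fin n)).map σ.toEmbedding)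
      (Finset.mem_map_of_mem _ (Finset.mem_Ici.2 (Fin.mk_le_mk.2 (by omega))))
    obtain ⟨j, hj, rfl⟩ := Finset.mem_map.1 hi
    have hcard : n - (m - 1) = n - m + 1 := by omega
    rw [Finset.card_map, Fin.card_Ici, hcard] at hle
    exact (hsort.monotone (Finset.mem_Ici.1 hj)).trans hle
  · intro h J hJ
    -- the smallest rank occurring in `J` witnesses the rejection
    set S := J.map σ.symm.toEmbedding
    have hkS : (⟨k - 1, by omega⟩ : Fin n) ∈ S := Finset.mem_map.2 ⟨_, hJ, by simp⟩
    obtain ⟨j, hj, hmin⟩ := S.exists_min_image id ⟨_, hkS⟩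
    have hjk : (j : ℕ) ≤ k - 1 := Fin.le_def.1 (hmin _ hkS)
    have hcard : J.card ≤ n - j := by
      rw [← Fin.card_Ici, ← Finset.card_map σ.symm.toEmbedding]
      exact Finset.card_le_card fun x hx => Finset.mem_Ici.2 (hmin x hx)
    have hJpos : 0 < J.card := Finset.card_pos.2 ⟨_, hJ⟩
    have hjJ : σ j ∈ J := by
      obtain ⟨i, hi, rfl⟩ := Finset.mem_map.1 hj
      simpa using hi
    refine ⟨σ j, hjJ, (h (j + 1) (by omega) (by omega)).trans ?_⟩
    exact div_le_div_of_nonneg_left hα.1.le (by exact_mod_cast hJpos)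
      (by exact_mod_cast (by omega : J.card ≤ n - (j + 1) + 1))
end

section
/- (FACT for Simes equals Hommel's procedure.) Let n ≥ 1, α ∈ (0,1), and let p ∈ [0,1]^n have distinct coordinates with order statistics p_(1) < ⋯ < p_(n). For each nonempty J ⊆ {1,…,n}, let the Simes local rule be Φ_J(p_J) = 1 if and only if there exists i ∈ {1,…,|J|} with q_(i) ≤ iα/|J|, where q_(1) ≤ ⋯ ≤ q_(|J|) are the order statistics of the subvector p_J. Then: (a) if there is no j ∈ {1,…,n} such that p_(n−j+k) > kα/j for all k ∈ {1,…,j}, the closed testing procedure rejects every hypothesis; (b) otherwise, letting j* be the largest j ∈ {1,…,n} such that p_(n−j+k) > kα/j for all k ∈ {1,…,j}, the closed testing procedure rejects exactly those hypotheses i with p_i ≤ α/j*. That is, the closure of Simes' method yields exactly the rejections of Hommel's procedure. -/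
/-- The Simes local rule rejects the intersection null over `J` iff some order
statistic `q_(i)` of the subvector `p_J` (computed via the sorting permutation)
satisfies `q_(i) ≤ i·α/|J|`. -/
def SimesRejects {n : ℕ} (α : ℝ) (p : Fin n → ℝ) (J : Finset (Fin n)) : Prop :=
  ∃ i : Fin J.card,
    subvec p J (Tuple.sort (subvec p J) i) ≤ ((i.1 + 1 : ℕ) : ℝ) * α / (J.card : ℝ)

/-- Hommel's condition at `j`: `p_(n−j+k) > kα/j` for all `k ∈ {1,…,j}`, where the
order statistics are given by the sorting permutation `σ`. -/
def HommelCond {n : ℕ} (α : ℝ) (p : Fin n → ℝ) (σ : Equiv.Perm (Fin n))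
    (j : ℕ) (hj1 : 1 ≤ j) (hjn : j ≤ n) : Prop :=
  ∀ k, ∀ _hk1 : 1 ≤ k, ∀ _hk2 : k ≤ j,
    (k : ℝ) * α / (j : ℝ) < p (σ ⟨n - j + k - 1, by omega⟩)

open Finset in
/-- Counting form of the Simes local rule. -/
theorem simesRejects_iff_card {n : ℕ} (α : ℝ) (p : Fin n → ℝ) (J : Finset (Fin n)) :
    SimesRejects α p J ↔ ∃ m : ℕ, 1 ≤ m ∧ m ≤ #J ∧
      m ≤ #{x ∈ J | p x ≤ (m : ℝ) * α / (#J : ℝ)} := by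
  have key (t : ℝ) (i : Fin #J) :
      subvec p J (Tuple.sort (subvec p J) i) ≤ t ↔ i.1 < #{x ∈ J | p x ≤ t} := by
    have hcard : #{k | (subvec p J ∘ Tuple.sort (subvec p J)) k ≤ t} =
        #{x ∈ J | p x ≤ t} := by
      refine card_bij (fun k _ => (J.orderIsoOfFin rfl (Tuple.sort (subvec p J) k)).1) ?_ ?_ ?_
      · intro k hk
        exact mem_filter.2 ⟨Subtype.prop _, (mem_filter.1 hk).2⟩
      · intro a _ b _ hab
        simpa using Subtype.ext hab
      · intro x hx
        rw [mem_filter] at hx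
        refine ⟨(Tuple.sort (subvec p J)).symm ((J.orderIsoOfFin rfl).symm ⟨x, hx.1⟩), ?_, ?_⟩
        · refine mem_filter.2 ⟨mem_univ _, ?_⟩
          simpa [subvec, -coe_orderIsoOfFin_apply] using hx.2
        · simp
    rw [← hcard]
    exact (Tuple.lt_card_le_iff_apply_le_of_monotone (Tuple.monotone_sort (subvec p J))).symm
  constructor
  · rintro ⟨i, hi⟩
    exact ⟨i.1 + 1, by omega, i.2, (key _ i).1 hi⟩
  · rintro ⟨m, hm1, hmJ, hm⟩
    refine ⟨⟨m - 1, by omega⟩, (key _ _).2 ?_⟩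
    simp only [Nat.sub_add_cancel hm1]
    omega

open Finset in
theorem card_filter_symm_mem_Ico {n : ℕ} (σ : Equiv.Perm (Fin n)) (a b : ℕ) (hb : b ≤ n) :
    #{x : Fin n | a ≤ (σ.symm x).1 ∧ (σ.symm x).1 < b} = b - a := by
  rw [← Nat.card_Ico]
  refine card_bij (fun x _ => (σ.symm x).1) ?_ ?_ ?_
  · simp
  · intro x _ y _ h
    exact σ.symm.injective (Fin.ext h)
  · intro r hr
    rw [mem_Ico] at hr
    exact ⟨σ ⟨r, by omega⟩, by simpa using hr, by simp⟩

open Finset in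
/-- If some set of size `j` escapes rejection by Simes, then so do the `j` largest p-values. -/
theorem hommelCond_of_not_simesRejects {n : ℕ} {α : ℝ} {p : Fin n → ℝ} {σ : Equiv.Perm (Fin n)}
    (hsort : Monotone (p ∘ σ)) {J : Finset (Fin n)} (hJ : ¬ SimesRejects α p J)
    (hj1 : 1 ≤ #J) (hjn : #J ≤ n) : HommelCond α p σ #J hj1 hjn := by
  intro k hk1 hk2
  by_contra! hle
  refine hJ ((simesRejects_iff_card α p J).2 ⟨k, hk1, hk2, ?_⟩)
  have hlow := card_filter_symm_mem_Ico σ 0 (n - #J + k) (by omega)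
  set A : Finset (Fin n) := {x | 0 ≤ (σ.symm x).1 ∧ (σ.symm x).1 < n - #J + k} with hA
  have hsub : A ∩ J ⊆ {x ∈ J | p x ≤ (k : ℝ) * α / (#J : ℝ)} := by
    intro x hx
    simp only [hA, mem_inter, mem_filter, mem_univ, true_and] at hx
    refine mem_filter.2 ⟨hx.2, le_trans ?_ hle⟩
    have := hsort (show σ.symm x ≤ ⟨n - #J + k - 1, by omega⟩ from
      Fin.le_def.2 (by have := hx.1.2; simp only; omega))
    simpa using this
  have hunion := card_union_add_card_inter A J
  have hle_n : #(A ∪ J) ≤ n := by simpa using card_le_univ (A ∪ J)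
  have := card_le_card hsub
  omega

open Finset in
/-- Under Hommel's condition at `j`, every hypothesis with p-value above `α / j` lies in
a set that Simes does not reject. -/
theorem HommelCond.exists_not_simesRejects {n : ℕ} {α : ℝ} {p : Fin n → ℝ}
    {σ : Equiv.Perm (Fin n)} (hsort : Monotone (p ∘ σ)) {j : ℕ} {hj1 : 1 ≤ j} {hjn : j ≤ n}
    (h : HommelCond α p σ j hj1 hjn) {i : Fin n} (hi : α / (j : ℝ) < p i) :
    ∃ J : Finset (Fin n), i ∈ J ∧ ¬ SimesRejects α p J := by
  have hU := card_filter_symm_mem_Ico σ (n - j + 1) n le_rfl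
  set U : Finset (Fin n) := {x | n - j + 1 ≤ (σ.symm x).1 ∧ (σ.symm x).1 < n} with hUdef
  obtain ⟨i', hi'U, hi', hmem⟩ : ∃ i', i' ∉ U ∧ α / (j : ℝ) < p i' ∧ i ∈ insert i' U := by
    by_cases hiU : i ∈ U
    · refine ⟨σ ⟨n - j, by omega⟩, by simp [hUdef], ?_, mem_insert_of_mem hiU⟩
      simpa using h 1 le_rfl hj1
    · exact ⟨i, hiU, hi, mem_insert_self _ _⟩
  refine ⟨insert i' U, hmem, fun hrej => ?_⟩
  have hcard : #(insert i' U) = j := by rw [card_insert_of_notMem hi'U, hU]; omega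
  obtain ⟨m, hm1, hmj, hm⟩ := (simesRejects_iff_card α p _).1 hrej
  rw [hcard] at hmj hm
  have hlt {x : Fin n} (hx : p x ≤ (m : ℝ) * α / (j : ℝ)) :
      (σ.symm x).1 < n - j + m - 1 := by
    by_contra! hge
    have hmono := hsort (show ⟨n - j + m - 1, by omega⟩ ≤ σ.symm x from Fin.le_def.2 hge)
    simp only [Function.comp_apply, Equiv.apply_symm_apply] at hmono
    exact absurd hx (not_le.2 ((h m hm1 hmj).trans_le hmono))
  have hV := card_filter_symm_mem_Ico σ (n - j + 1) (n - j + m - 1) (by omega)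
  set V : Finset (Fin n) := {x | n - j + 1 ≤ (σ.symm x).1 ∧ (σ.symm x).1 < n - j + m - 1}
    with hVdef
  have hUV {x : Fin n} (hxU : x ∈ U) (hx : p x ≤ (m : ℝ) * α / (j : ℝ)) : x ∈ V := by
    simp only [hUdef, mem_filter, mem_univ, true_and] at hxU
    simpa [hVdef] using ⟨hxU.1, hlt hx⟩
  rcases hm1.eq_or_lt with rfl | hm2
  · have hsub : {x ∈ insert i' U | p x ≤ ((1 : ℕ) : ℝ) * α / (j : ℝ)} ⊆ V := by
      intro x hx
      obtain ⟨hxI, hxle⟩ := mem_filter.1 hx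
      rcases mem_insert.1 hxI with rfl | hxU
      · rw [Nat.cast_one, one_mul] at hxle
        exact absurd hi' (not_lt.2 hxle)
      · exact hUV hxU hxle
    have := card_le_card hsub
    omega
  · have hsub : {x ∈ insert i' U | p x ≤ (m : ℝ) * α / (j : ℝ)} ⊆ insert i' V := by
      intro x hx
      obtain ⟨hxI, hxle⟩ := mem_filter.1 hx
      rcases mem_insert.1 hxI with rfl | hxU
      · exact mem_insert_self _ _
      · exact mem_insert_of_mem (hUV hxU hxle)
    have := card_le_card hsub
    have := card_insert_le i' V
    omega

/-- **The closure of Simes' method is Hommel's procedure.** With distinct p-values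
sorted via `σ`: (a) if there is no `j` with `p_(n−j+k) > kα/j` for all `k ≤ j`, closed
testing with the Simes local rules rejects every hypothesis; (b) otherwise, letting
`j*` be the largest such `j`, it rejects exactly the hypotheses `i` with `p i ≤ α/j*`. -/
theorem fact_simes_is_hommel
    (n : ℕ) (hn : 1 ≤ n) (α : ℝ) (hα : α ∈ Set.Ioo (0 : ℝ) 1)
    (p : Fin n → ℝ) (hp : ∀ i, p i ∈ Set.Icc (0 : ℝ) 1)
    (σ : Equiv.Perm (Fin n)) (hsort : StrictMono (p ∘ σ)) :
    ((¬ ∃ j, ∃ hj1 : 1 ≤ j, ∃ hjn : j ≤ n, HommelCond α p σ j hj1 hjn) →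
      ∀ i : Fin n, ∀ J : Finset (Fin n), i ∈ J → SimesRejects α p J)
    ∧ (∀ jstar, ∀ hj1 : 1 ≤ jstar, ∀ hjn : jstar ≤ n,
        HommelCond α p σ jstar hj1 hjn →
        (∀ j, ∀ hj1' : 1 ≤ j, ∀ hjn' : j ≤ n,
          HommelCond α p σ j hj1' hjn' → j ≤ jstar) →
        ∀ i : Fin n,
          ((∀ J : Finset (Fin n), i ∈ J → SimesRejects α p J)
            ↔ p i ≤ α / (jstar : ℝ))) := by
  have hcond {i : Fin n} {J : Finset (Fin n)} (hi : i ∈ J) (hJ : ¬ SimesRejects α p J) :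
      ∃ hj1 : 1 ≤ J.card, ∃ hjn : J.card ≤ n, HommelCond α p σ J.card hj1 hjn :=
    ⟨Finset.card_pos.2 ⟨i, hi⟩, by simpa using Finset.card_le_univ J,
      hommelCond_of_not_simesRejects hsort.monotone hJ _ _⟩
  refine ⟨fun hno i J hi => ?_, fun jstar hj1 hjn hH hmax i => ⟨fun hall => ?_, fun hle J hi => ?_⟩⟩
  · by_contra hJ
    exact hno ⟨J.card, hcond hi hJ⟩
  · by_contra! hlt
    obtain ⟨J, hiJ, hJ⟩ := hH.exists_not_simesRejects hsort.monotone hlt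
    exact hJ (hall J hiJ)
  · by_contra hJ
    obtain ⟨hJ1, hJn, hJH⟩ := hcond hi hJ
    have hJle : (J.card : ℝ) ≤ (jstar : ℝ) := by exact_mod_cast hmax _ hJ1 hJn hJH
    have hJpos : (0 : ℝ) < J.card := by exact_mod_cast hJ1
    refine hJ ((simesRejects_iff_card α p J).2 ⟨1, le_rfl, hJ1, Finset.card_pos.2 ⟨i, ?_⟩⟩)
    rw [Finset.mem_filter, Nat.cast_one, one_mul]
    exact ⟨hi, hle.trans (div_le_div_of_nonneg_left hα.1.le hJpos hJle)⟩
end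

section
/- (Necessity in the Consonance-Closure-Monotonicity lemma.) Let f : [0,1] → ℝ be continuous and strictly increasing, let k ≥ 1, and let c_1, c_k be real critical values with f(0) ≤ c_1 < f(1), c_k ≥ k·f(0), and c_k > k·c_1 (failure of the sub-linear growth condition). Then there exists x ∈ [0,1] such that k·f(x) ≤ c_k and f(x) > c_1; consequently, the vector p ∈ [0,1]^k with all coordinates equal to x is rejected by the size-k monotone combination test (∑_{i=1}^k f(p_i) ≤ c_k) while no singleton test rejects (f(p_i) > c_1 for all i), so the test family is not consonant. -/
/-- **Necessity in the Consonance-Closure-Monotonicity (CCM) lemma.** If the sub-linear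
growth condition fails (`c_k > k·c_1`) for a continuous strictly increasing combining
function `f` with `f(0) ≤ c_1 < f(1)` and `c_k ≥ k·f(0)`, then there is `x ∈ [0,1]`
with `k·f(x) ≤ c_k` and `f(x) > c_1`: the constant vector at `x` is rejected by the
size-`k` monotone combination test while no singleton test rejects, so the family is
not consonant. -/
theorem ccm_necessity (f : ℝ → ℝ)
    (hf_cont : ContinuousOn f (Set.Icc (0 : ℝ) 1))
    (hf_mono : StrictMonoOn f (Set.Icc (0 : ℝ) 1))
    (k : ℕ) (hk : 1 ≤ k) (c1 ck : ℝ)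
    (h0 : f 0 ≤ c1) (h1 : c1 < f 1)
    (hck0 : (k : ℝ) * f 0 ≤ ck) (hfail : (k : ℝ) * c1 < ck) :
    ∃ x ∈ Set.Icc (0 : ℝ) 1,
      (k : ℝ) * f x ≤ ck ∧ c1 < f x ∧ (∑ _i : Fin k, f x) ≤ ck := by
  have hk0 : (0 : ℝ) < k := by exact_mod_cast hk
  have hc1 : c1 < min (f 1) (ck / k) :=
    lt_min h1 ((lt_div_iff₀' hk0).2 hfail)
  obtain ⟨x, hx, hfx⟩ := intermediate_value_Icc zero_le_one hf_cont
    ⟨h0.trans hc1.le, min_le_left (f 1) (ck / k)⟩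
  have hle : (k : ℝ) * f x ≤ ck :=
    (le_div_iff₀' hk0).1 (hfx.trans_le (min_le_right _ _))
  exact ⟨x, hx, hle, hc1.trans_eq hfx.symm, by simpa using hle⟩
end

section
/- (Non-consonance of Stouffer's combination for α < 1/2.) Let F : ℝ → ℝ be the cumulative distribution function of the standard Gaussian measure on ℝ (mean 0, variance 1). Let α ∈ (0, 1/2) and let c_1 ∈ ℝ satisfy F(c_1) = α. Then c_1 < 0, and for every integer k ≥ 2, setting c_k = √k·c_1, there exists x ∈ ℝ with x > c_1 and k·x ≤ c_k. Consequently, the constant vector with all k coordinates equal to F(x) is rejected by the size-k Stouffer test (the sum of the k Gaussian quantiles equals k·x ≤ c_k) while no singleton Stouffer test rejects (x > c_1), so the closure of Stouffer's combination is not consonant when α < 1/2. -/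
open ProbabilityTheory

/-- By symmetry, a centered Gaussian measure gives mass at least `1 / 2` to `Iic c`
when `0 ≤ c`. -/
lemma one_half_le_gaussianReal_real_Iic (v : NNReal) {c : ℝ} (hc : 0 ≤ c) :
    1 / 2 ≤ (gaussianReal 0 v).real (Set.Iic c) := by
  have hsymm : (gaussianReal 0 v).real (Set.Ici 0) = (gaussianReal 0 v).real (Set.Iic 0) := by
    have hmap : (gaussianReal 0 v).map (fun x ↦ -x) = gaussianReal 0 v := by
      simpa using gaussianReal_map_neg (μ := 0) (v := v)
    conv_lhs => rw [← hmap]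
    rw [MeasureTheory.map_measureReal_apply measurable_neg measurableSet_Ici]
    congr 1
    ext x
    simp
  have hunion := MeasureTheory.measureReal_union_le (μ := gaussianReal 0 v)
    (Set.Iic (0 : ℝ)) (Set.Ici 0)
  rw [Set.Iic_union_Ici, MeasureTheory.probReal_univ] at hunion
  have hmono : (gaussianReal 0 v).real (Set.Iic 0) ≤ (gaussianReal 0 v).real (Set.Iic c) :=
    MeasureTheory.measureReal_mono (Set.Iic_subset_Iic.mpr hc)
  linarith

/-- **Non-consonance of Stouffer's combination for `α < 1/2`.** Let `F` be the standard
Gaussian cumulative distribution function and let `F(c_1) = α` with `α ∈ (0, 1/2)`.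
Then `c_1 < 0`, and for every `k ≥ 2` (with `c_k = √k·c_1`) there is `x > c_1` with
`k·x ≤ √k·c_1`: the constant vector with all coordinates equal to `F(x)` is rejected by
the size-`k` Stouffer test while no singleton test rejects, so the closure of
Stouffer's combination is not consonant. -/
theorem stouffer_not_consonant (F : ℝ → ℝ)
    (hF : ∀ x, F x = ((gaussianReal 0 1) (Set.Iic x)).toReal)
    (α : ℝ) (hα : α ∈ Set.Ioo (0 : ℝ) (1 / 2)) (c1 : ℝ) (hc1 : F c1 = α) :
    c1 < 0 ∧ ∀ k : ℕ, 2 ≤ k → ∃ x : ℝ,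
      c1 < x ∧ (k : ℝ) * x ≤ Real.sqrt k * c1 := by
  have hneg : c1 < 0 := by
    by_contra! hc
    have h := one_half_le_gaussianReal_real_Iic 1 hc
    rw [MeasureTheory.measureReal_def, ← hF, hc1] at h
    exact absurd hα.2 (not_lt.mpr h)
  refine ⟨hneg, fun k hk ↦ ⟨Real.sqrt k * c1 / k, ?_, ?_⟩⟩
  · have hk1 : (1 : ℝ) < k := by exact_mod_cast hk
    have hsqrt : Real.sqrt k < k := by
      rw [Real.sqrt_lt' (by linarith)]
      nlinarith
    rw [lt_div_iff₀ (by linarith)]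
    nlinarith
  · have hk0 : (k : ℝ) ≠ 0 := by
      norm_cast
      omega
    exact (mul_div_cancel₀ _ hk0).le
end
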